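/- Fix δ₀ ∈ (0,1). There exist constants c₁ > 0, C > 0 and λ₀ > 0, all independent of λ, such that for every 0 < λ < λ₀ and every E with δ₀ < |E| < 2 − δ₀, the Furstenberg measure ν = ν_E^{(λ)} satisfies ν(I) ≤ C |I|^{c₁/2} for every arc I of the circle; in particular the dimension of ν_E^{(λ)} is bounded below by a positive constant independent of λ. -/

import Mathlib

open MeasureTheory

noncomputable section

instance : Fact (0 < 2 * Real.pi) := ⟨by have := Real.pi_pos; linarith⟩

/-- Single-step Anderson–Bernoulli matrix `g_E(ε) = [[E - λε, -1],[1,0]]`. -/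
def gE (lam E x : ℝ) : Matrix (Fin 2) (Fin 2) ℝ := !![E - lam * x, -1; 1, 0]

/-- The projective action `τ_g(θ)` of `g ∈ SL₂(ℝ)`, as a point of the circle
`ℝ/2πℤ`: the argument of `(a cos θ + b sin θ) + i (c cos θ + d sin θ)`. -/
def tauC (g : Matrix (Fin 2) (Fin 2) ℝ) (θ : ℝ) : AddCircle (2 * Real.pi) :=
  ((Complex.arg ((g 0 0 * Real.cos θ + g 0 1 * Real.sin θ : ℝ) +
      Complex.I * (g 1 0 * Real.cos θ + g 1 1 * Real.sin θ : ℝ)) : ℝ) :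
    AddCircle (2 * Real.pi))

/-- The projective action of `g` as a self-map of the circle `ℝ/2πℤ`. -/
def tauMap (g : Matrix (Fin 2) (Fin 2) ℝ) :
    AddCircle (2 * Real.pi) → AddCircle (2 * Real.pi) :=
  AddCircle.liftIco (2 * Real.pi) 0 fun θ => tauC g θ

/-- The arc of the circle `ℝ/2πℤ` obtained by projecting the interval `(a, a+l)`. -/
def arc (a l : ℝ) : Set (AddCircle (2 * Real.pi)) :=
  (fun θ : ℝ => (θ : AddCircle (2 * Real.pi))) '' Set.Ioo a (a + l)

/-- `ν` is stationary for `μ_{λ,E} = ½ δ_{g_E(1)} + ½ δ_{g_E(-1)}`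
(the defining property of the Furstenberg measure `ν_E^{(λ)}`). -/
def Stationary (lam E : ℝ) (ν : Measure (AddCircle (2 * Real.pi))) : Prop :=
  ∀ s : Set (AddCircle (2 * Real.pi)), MeasurableSet s →
    ν s = (ν (tauMap (gE lam E 1) ⁻¹' s) + ν (tauMap (gE lam E (-1)) ⁻¹' s)) / 2

/-- The real cross product of two complex numbers. -/
def cross (z w : ℂ) : ℝ := z.re * w.im - z.im * w.re

/-- The real inner product of two complex numbers. -/
def dot (z w : ℂ) : ℝ := z.re * w.re + z.im * w.im

/-- A horizontal shear by `t` followed by multiplication by `ω`. -/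
def shearRot (ω : ℂ) (t : ℝ) (z : ℂ) : ℂ := ω * (z + (t * z.im : ℝ))

/-- The quartic angular correction solving the cohomological equation of the rotation by `ω`. -/
def corrector (ω z : ℂ) : ℝ :=
  (1 / (2 * (ω ^ 2 - 1)) * (z / ‖z‖) ^ 2 - 1 / (4 * (ω ^ 4 - 1)) * (z / ‖z‖) ^ 4).re

/-- The corrected logarithm of the squared norm. -/
def corrLog (ω : ℂ) (t : ℝ) (z : ℂ) : ℝ := 2 * Real.log ‖z‖ + t ^ 2 * corrector ω z

/-- The Lyapunov function of the random product of the maps `shearRot ω (± t)`. -/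
def lyap (ω : ℂ) (t : ℝ) (z : ℂ) : ℝ := Real.exp (-(1 / 400) * corrLog ω t z)

lemma norm_sq_eq_dot (z : ℂ) : ‖z‖ ^ 2 = dot z z := by
  rw [← Complex.normSq_eq_norm_sq, Complex.normSq_apply, dot]

lemma cross_sq_add_dot_sq (z w : ℂ) : cross z w ^ 2 + dot z w ^ 2 = (‖z‖ * ‖w‖) ^ 2 := by
  rw [mul_pow, norm_sq_eq_dot, norm_sq_eq_dot]; simp only [cross, dot]; ring

lemma cross_smul_smul (a b : ℝ) (z w : ℂ) : cross (a * z) (b * w) = a * b * cross z w := by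
  simp [cross]; ring

lemma dot_self_of_norm_one {ω : ℂ} (hω : ‖ω‖ = 1) : ω.re ^ 2 + ω.im ^ 2 = 1 := by
  have := norm_sq_eq_dot ω
  rw [hω] at this; simp only [dot] at this; linarith

lemma cross_shearRot {ω : ℂ} (hω : ‖ω‖ = 1) (t : ℝ) (z w : ℂ) :
    cross (shearRot ω t z) (shearRot ω t w) = cross z w := by
  have h := dot_self_of_norm_one hω
  simp [cross, shearRot]
  linear_combination (z.re * w.im - z.im * w.re) * h

lemma dot_shearRot {ω : ℂ} (hω : ‖ω‖ = 1) (t : ℝ) (z w : ℂ) :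
    dot (shearRot ω t z) (shearRot ω t w) =
      dot z w + t * (z.im * w.re + z.re * w.im) + t ^ 2 * (z.im * w.im) := by
  have h := dot_self_of_norm_one hω
  simp [dot, shearRot]
  linear_combination ((z.re + t * z.im) * (w.re + t * w.im) + z.im * w.im) * h

lemma shearRot_ne_zero {ω : ℂ} (hω : ‖ω‖ = 1) (t : ℝ) {z : ℂ} (hz : z ≠ 0) :
    shearRot ω t z ≠ 0 := by
  have hω0 : ω ≠ 0 := by rintro rfl; simp at hω
  refine mul_ne_zero hω0 fun h => hz ?_
  have him : z.im = 0 := by simpa using congrArg Complex.im h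
  have hre : z.re = 0 := by simpa [him] using congrArg Complex.re h
  exact Complex.ext hre him

lemma shearRot_smul (ω : ℂ) (t r : ℝ) (z : ℂ) :
    shearRot ω t (r * z) = r * shearRot ω t z := by
  simp [shearRot]; ring

lemma corrector_smul (ω : ℂ) {r : ℝ} (hr : 0 < r) (z : ℂ) :
    corrector ω (r * z) = corrector ω z := by
  have hr' : (r : ℂ) ≠ 0 := by exact_mod_cast hr.ne'
  have : (r * z / ‖(r : ℂ) * z‖ : ℂ) = z / ‖z‖ := by
    rw [norm_mul, Complex.norm_real, Real.norm_of_nonneg hr.le, Complex.ofReal_mul,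
      mul_div_mul_left _ _ hr']
  simp only [corrector, this]

lemma corrLog_smul (ω : ℂ) (t : ℝ) {r : ℝ} (hr : 0 < r) {z : ℂ} (hz : z ≠ 0) :
    corrLog ω t (r * z) = 2 * Real.log r + corrLog ω t z := by
  rw [corrLog, corrLog, corrector_smul ω hr, norm_mul, Complex.norm_real,
    Real.norm_of_nonneg hr.le, Real.log_mul hr.ne' (norm_ne_zero_iff.2 hz)]
  ring

lemma exp_le_one_add_add_sq {x : ℝ} (hx : |x| ≤ 1) : Real.exp x ≤ 1 + x + x ^ 2 := by
  have := (abs_le.1 (Real.abs_exp_sub_one_sub_id_le hx)).2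
  linarith

lemma sub_sq_le_log_one_add {x : ℝ} (hx : -(1 / 2) ≤ x) :
    x - 2 * x ^ 2 ≤ Real.log (1 + x) := by
  have hpos : 0 < 1 + x := by linarith
  refine le_trans ?_ (Real.one_sub_inv_le_log_of_pos hpos)
  rw [← sub_nonneg]
  have : 1 - (1 + x)⁻¹ - (x - 2 * x ^ 2) = x ^ 2 * (1 + 2 * x) / (1 + x) := by field_simp; ring
  rw [this]
  exact div_nonneg (mul_nonneg (sq_nonneg x) (by linarith)) hpos.le

lemma abs_log_one_add_le {x : ℝ} (hx : |x| ≤ 1 / 2) : |Real.log (1 + x)| ≤ 2 * |x| := by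
  obtain ⟨h1, h2⟩ := abs_le.1 hx
  have hpos : 0 < 1 + x := by linarith
  have hup := Real.log_le_sub_one_of_pos hpos
  have hlo := sub_sq_le_log_one_add (x := x) (by linarith)
  have hsq : 2 * x ^ 2 ≤ |x| := by rw [← sq_abs]; nlinarith [abs_nonneg x]
  rw [abs_le]
  constructor <;> linarith [neg_abs_le x, le_abs_self x]

lemma norm_div_norm_sub_le {z w : ℂ} (hw : ‖w‖ = 1) (hz : z ≠ 0) :
    ‖z / ‖z‖ - w‖ ≤ 2 * ‖z - w‖ := by
  have hz' : (‖z‖ : ℂ) ≠ 0 := by exact_mod_cast norm_ne_zero_iff.2 hz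
  have h1 : ‖z / ‖z‖ - z‖ = |‖w‖ - ‖z‖| := by
    have : z / ‖z‖ - z = (z / ‖z‖) * ((1 - ‖z‖ : ℝ) : ℂ) := by push_cast; field_simp
    rw [this, norm_mul, norm_div, Complex.norm_real, Complex.norm_real, norm_norm,
      div_self (norm_ne_zero_iff.2 hz), one_mul, Real.norm_eq_abs, hw]
  have h2 : |‖w‖ - ‖z‖| ≤ ‖z - w‖ := by
    rw [norm_sub_rev]; exact abs_norm_sub_norm_le w z
  calc ‖z / ‖z‖ - w‖ ≤ ‖z / ‖z‖ - z‖ + ‖z - w‖ := norm_sub_le_norm_sub_add_norm_sub _ _ _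
    _ ≤ 2 * ‖z - w‖ := by rw [h1]; linarith

section Drift

variable {ω : ℂ} {m : ℝ}

lemma norm_coeff_le (hm : 0 < m) (c : ℝ) (hc : 0 < c) {ξ : ℂ} (h : m ≤ ‖ξ‖) :
    ‖1 / ((c : ℂ) * ξ)‖ ≤ 1 / (c * m) := by
  rw [norm_div, norm_one, norm_mul, Complex.norm_real, Real.norm_of_nonneg hc.le]
  gcongr

lemma abs_corrector_le (hm : 0 < m) (h2 : m ≤ ‖ω ^ 2 - 1‖) (h4 : m ≤ ‖ω ^ 4 - 1‖) {z : ℂ}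
    (hz : z ≠ 0) : |corrector ω z| ≤ 1 / m := by
  have hu : ‖z / ‖z‖‖ = 1 := by
    rw [norm_div, Complex.norm_real, norm_norm, div_self (norm_ne_zero_iff.2 hz)]
  refine (Complex.abs_re_le_norm _).trans ((norm_sub_le _ _).trans ?_)
  rw [norm_mul, norm_mul, norm_pow, norm_pow, hu]
  have hA := norm_coeff_le hm 2 (by norm_num) h2
  have hB := norm_coeff_le hm 4 (by norm_num) h4
  push_cast at hA hB
  have : 1 / (2 * m) + 1 / (4 * m) ≤ 1 / m := by
    rw [← sub_nonneg]
    have : 1 / m - (1 / (2 * m) + 1 / (4 * m)) = 1 / (4 * m) := by field_simp; norm_num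
    rw [this]; positivity
  linarith

lemma abs_corrector_sub_le (hm : 0 < m) (h2 : m ≤ ‖ω ^ 2 - 1‖) (h4 : m ≤ ‖ω ^ 4 - 1‖) {z w : ℂ}
    (hw : ‖w‖ = 1) (hz : z ≠ 0) : |corrector ω z - corrector ω w| ≤ 4 / m * ‖z - w‖ := by
  set u : ℂ := z / ‖z‖ with hu_def
  have hu : ‖u‖ = 1 := by
    rw [hu_def, norm_div, Complex.norm_real, norm_norm, div_self (norm_ne_zero_iff.2 hz)]
  have hww : w / ‖w‖ = w := by simp [hw]
  have huw : ‖u - w‖ ≤ 2 * ‖z - w‖ := norm_div_norm_sub_le hw hz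
  have hA := norm_coeff_le hm 2 (by norm_num) h2
  have hB := norm_coeff_le hm 4 (by norm_num) h4
  push_cast at hA hB
  have hsq : ‖u ^ 2 - w ^ 2‖ ≤ 2 * ‖u - w‖ := by
    rw [show u ^ 2 - w ^ 2 = (u + w) * (u - w) by ring, norm_mul]
    gcongr
    linarith [norm_add_le u w]
  have hqu : ‖u ^ 4 - w ^ 4‖ ≤ 4 * ‖u - w‖ := by
    rw [show u ^ 4 - w ^ 4 = (u ^ 2 + w ^ 2) * (u ^ 2 - w ^ 2) by ring, norm_mul]
    have : ‖u ^ 2 + w ^ 2‖ ≤ 2 := by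
      refine (norm_add_le _ _).trans ?_
      rw [norm_pow, norm_pow, hu, hw]; norm_num
    nlinarith [norm_nonneg (u ^ 2 - w ^ 2)]
  have hdiff : corrector ω z - corrector ω w =
      (1 / (2 * (ω ^ 2 - 1)) * (u ^ 2 - w ^ 2) - 1 / (4 * (ω ^ 4 - 1)) * (u ^ 4 - w ^ 4)).re := by
    simp only [corrector, hww, ← hu_def, ← Complex.sub_re]
    congr 1; ring
  rw [hdiff]
  refine (Complex.abs_re_le_norm _).trans ((norm_sub_le _ _).trans ?_)
  rw [norm_mul, norm_mul]
  calc _ ≤ 1 / (2 * m) * (2 * ‖u - w‖) + 1 / (4 * m) * (4 * ‖u - w‖) := by gcongr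
    _ = 2 / m * ‖u - w‖ := by field_simp; ring
    _ ≤ 2 / m * (2 * ‖z - w‖) := by gcongr
    _ = 4 / m * ‖z - w‖ := by ring

lemma corrector_rotate (hω : ‖ω‖ = 1) (h2 : ω ^ 2 - 1 ≠ 0) (h4 : ω ^ 4 - 1 ≠ 0) {z : ℂ}
    (hz : ‖z‖ = 1) :
    2 * (corrector ω (ω * z) - corrector ω z) = (z ^ 2).re - (z ^ 4).re / 2 := by
  have hωz : ‖ω * z‖ = 1 := by rw [norm_mul, hω, hz, one_mul]
  have h : 1 / (2 * (ω ^ 2 - 1)) * (ω * z) ^ 2 - 1 / (4 * (ω ^ 4 - 1)) * (ω * z) ^ 4 -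
      (1 / (2 * (ω ^ 2 - 1)) * z ^ 2 - 1 / (4 * (ω ^ 4 - 1)) * z ^ 4) =
      ((1 / 2 : ℝ) : ℂ) * z ^ 2 - ((1 / 4 : ℝ) : ℂ) * z ^ 4 := by
    push_cast; field_simp; ring
  have h' := congrArg Complex.re h
  rw [Complex.sub_re, Complex.sub_re (((1 / 2 : ℝ) : ℂ) * z ^ 2), Complex.re_ofReal_mul, Complex.re_ofReal_mul] at h'
  simp only [corrector, hωz, hz, Complex.ofReal_one, div_one]
  linarith

lemma norm_shearRot_sq (hω : ‖ω‖ = 1) (t : ℝ) {z : ℂ} (hz : ‖z‖ = 1) :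
    ‖shearRot ω t z‖ ^ 2 = 1 + (2 * t * (z.re * z.im) + t ^ 2 * z.im ^ 2) := by
  rw [norm_sq_eq_dot, dot_shearRot hω, ← norm_sq_eq_dot, hz]; ring

lemma norm_shearRot_sub_le (hω : ‖ω‖ = 1) (t : ℝ) {z : ℂ} (hz : ‖z‖ = 1) :
    ‖shearRot ω t z - ω * z‖ ≤ |t| := by
  have : shearRot ω t z - ω * z = ω * ((t * z.im : ℝ) : ℂ) := by simp only [shearRot]; ring
  rw [this, norm_mul, hω, one_mul, Complex.norm_real, Real.norm_eq_abs, abs_mul]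
  have := Complex.abs_im_le_norm z
  rw [hz] at this
  nlinarith [abs_nonneg t]

lemma abs_corrLog_shearRot_sub_le (hω : ‖ω‖ = 1) (hm : 0 < m) (hm1 : m ≤ 1)
    (h2 : m ≤ ‖ω ^ 2 - 1‖) (h4 : m ≤ ‖ω ^ 4 - 1‖) {t r : ℝ} (ht : 0 < t) (htm : t ≤ m / 64)
    (hr : |r| = t) {z : ℂ} (hz : ‖z‖ = 1) :
    |corrLog ω t (shearRot ω r z) - corrLog ω t z| ≤ 5 * t := by
  have hz0 : z ≠ 0 := by rintro rfl; simp at hz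
  have hT0 := shearRot_ne_zero hω r hz0
  have hc1 := abs_corrector_le hm h2 h4 hT0
  have hc2 := abs_corrector_le hm h2 h4 hz0
  have hb := dot_self_of_norm_one hz
  set η : ℝ := 2 * r * (z.re * z.im) + r ^ 2 * z.im ^ 2 with hη
  have hlog : 2 * Real.log ‖shearRot ω r z‖ = Real.log (1 + η) := by
    rw [← norm_shearRot_sq hω r hz, Real.log_pow]; norm_num
  have hab : |2 * (z.re * z.im)| ≤ 1 := by
    rw [abs_le]; constructor <;> nlinarith [sq_nonneg (z.re + z.im), sq_nonneg (z.re - z.im)]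
  have hη1 : |η| ≤ 65 / 64 * t := by
    rw [hη]
    refine (abs_add_le _ _).trans ?_
    rw [show 2 * r * (z.re * z.im) = r * (2 * (z.re * z.im)) by ring, abs_mul, hr, abs_mul (r ^ 2),
      abs_pow, hr, abs_of_nonneg (sq_nonneg z.im)]
    have : z.im ^ 2 ≤ 1 := by nlinarith [sq_nonneg z.re]
    nlinarith [mul_nonneg (sq_nonneg t) (sub_nonneg.2 this)]
  have hl := abs_log_one_add_le (x := η) (by linarith)
  have htp : t ^ 2 * (1 / m) ≤ t / 64 := by
    rw [mul_one_div, div_le_iff₀ hm]; nlinarith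
  have e : corrLog ω t (shearRot ω r z) - corrLog ω t z = Real.log (1 + η) +
      t ^ 2 * corrector ω (shearRot ω r z) - t ^ 2 * corrector ω z := by
    simp only [corrLog, hlog, hz, Real.log_one]; ring
  rw [e]
  have e1 : |t ^ 2 * corrector ω (shearRot ω r z)| ≤ t / 64 := by
    rw [abs_mul, abs_of_nonneg (sq_nonneg t)]
    exact (mul_le_mul_of_nonneg_left hc1 (sq_nonneg t)).trans htp
  have e2 : |t ^ 2 * corrector ω z| ≤ t / 64 := by
    rw [abs_mul, abs_of_nonneg (sq_nonneg t)]
    exact (mul_le_mul_of_nonneg_left hc2 (sq_nonneg t)).trans htp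
  have := abs_le.1 (hl.trans (mul_le_mul_of_nonneg_left hη1 two_pos.le))
  have e1' := abs_le.1 e1
  have e2' := abs_le.1 e2
  rw [abs_le]; constructor <;> linarith [this.1, this.2, e1'.1, e1'.2, e2'.1, e2'.2]

lemma corrLog_drift (hω : ‖ω‖ = 1) (hm : 0 < m) (hm1 : m ≤ 1)
    (h2 : m ≤ ‖ω ^ 2 - 1‖) (h4 : m ≤ ‖ω ^ 4 - 1‖) {t : ℝ} (ht : 0 < t) (htm : t ≤ m / 64)
    {z : ℂ} (hz : ‖z‖ = 1) :
    t ^ 2 / 4 ≤ corrLog ω t (shearRot ω t z) + corrLog ω t (shearRot ω (-t) z) -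
      2 * corrLog ω t z := by
  have hz0 : z ≠ 0 := by rintro rfl; simp at hz
  have hωz : ‖ω * z‖ = 1 := by rw [norm_mul, hω, hz, one_mul]
  have hlip : ∀ r : ℝ, |r| = t →
      corrector ω (ω * z) - 1 / 16 ≤ corrector ω (shearRot ω r z) := by
    intro r hr
    have h := abs_corrector_sub_le hm h2 h4 hωz (shearRot_ne_zero hω r hz0)
    have h' : 4 / m * ‖shearRot ω r z - ω * z‖ ≤ 1 / 16 := by
      calc _ ≤ 4 / m * (m / 64) := by
            gcongr; exact (norm_shearRot_sub_le hω r hz).trans (hr ▸ htm)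
        _ = 1 / 16 := by field_simp; norm_num
    linarith [(abs_le.1 (h.trans h')).1]
  have hp := hlip t (abs_of_pos ht)
  have hn := hlip (-t) (by rw [abs_neg, abs_of_pos ht])
  have hne : ∀ ξ : ℂ, m ≤ ‖ξ‖ → ξ ≠ 0 := by
    rintro ξ h rfl; rw [norm_zero] at h; linarith
  have hrot := corrector_rotate hω (hne _ h2) (hne _ h4) hz
  have hb := dot_self_of_norm_one hz
  set a := z.re with ha
  set b := z.im with hbdef
  have hre2 : (z ^ 2).re = a ^ 2 - b ^ 2 := by simp [pow_two, ← ha, ← hbdef]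
  have hre4 : (z ^ 4).re = (a ^ 2 - b ^ 2) ^ 2 - 4 * a ^ 2 * b ^ 2 := by
    rw [show z ^ 4 = (z * z) * (z * z) by ring]
    simp only [Complex.mul_re, Complex.mul_im, ← ha, ← hbdef]; ring
  set x : ℝ := t ^ 2 * (2 * b ^ 2 - 4 * a ^ 2 * b ^ 2) with hx
  have ha2 : a ^ 2 = 1 - b ^ 2 := by linarith
  have hb1 : b ^ 2 ≤ 1 := by nlinarith [sq_nonneg a]
  have hgb : |2 * b ^ 2 - 4 * a ^ 2 * b ^ 2| ≤ 2 := by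
    rw [ha2, abs_le]; constructor <;> nlinarith [sq_nonneg (2 * b ^ 2 - 1), sq_nonneg b]
  have ht64 : t ≤ 1 / 64 := by linarith
  have hxb : |x| ≤ 2 * t ^ 2 := by
    rw [hx, abs_mul, abs_of_nonneg (sq_nonneg t)]; nlinarith [sq_nonneg t]
  have htt : t ^ 2 ≤ 1 / 4096 := by nlinarith
  have hxx : x ^ 2 ≤ t ^ 2 / 1024 := by
    rw [← sq_abs]; nlinarith [abs_nonneg x, sq_nonneg t]
  have hxl : -(1 / 2) ≤ x := by linarith [(abs_le.1 hxb).1]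
  have hlog : x - 2 * x ^ 2 ≤ 2 * Real.log ‖shearRot ω t z‖ + 2 * Real.log ‖shearRot ω (-t) z‖ := by
    have hTp : ‖shearRot ω t z‖ ^ 2 ≠ 0 := by
      have := shearRot_ne_zero hω t hz0; positivity
    have hTn : ‖shearRot ω (-t) z‖ ^ 2 ≠ 0 := by
      have := shearRot_ne_zero hω (-t) hz0; positivity
    have e : 2 * Real.log ‖shearRot ω t z‖ + 2 * Real.log ‖shearRot ω (-t) z‖ =
        Real.log (‖shearRot ω t z‖ ^ 2 * ‖shearRot ω (-t) z‖ ^ 2) := by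
      rw [Real.log_mul hTp hTn, Real.log_pow, Real.log_pow]; norm_num
    rw [e]
    refine (sub_sq_le_log_one_add hxl).trans (Real.log_le_log (by linarith) ?_)
    rw [norm_shearRot_sq hω t hz, norm_shearRot_sq hω (-t) hz, hx, ← ha, ← hbdef]
    nlinarith [sq_nonneg (t ^ 2 * b ^ 2)]
  have hid : x + t ^ 2 * ((z ^ 2).re - (z ^ 4).re / 2) = t ^ 2 / 2 := by
    rw [hx, hre2, hre4]
    linear_combination (-(t ^ 2 / 2) * (a ^ 2 + b ^ 2 - 1)) * hb
  simp only [corrLog, hz, Real.log_one]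
  have := mul_le_mul_of_nonneg_left (add_le_add hp hn) (sq_nonneg t)
  have hrot' : t ^ 2 * (2 * (corrector ω (ω * z) - corrector ω z)) =
      t ^ 2 * ((z ^ 2).re - (z ^ 4).re / 2) := by rw [hrot]
  nlinarith

end Drift

section Lyapunov

variable {ω : ℂ} {m t : ℝ}

lemma lyap_contract (hω : ‖ω‖ = 1) (hm : 0 < m) (hm1 : m ≤ 1)
    (h2 : m ≤ ‖ω ^ 2 - 1‖) (h4 : m ≤ ‖ω ^ 4 - 1‖) (ht : 0 < t) (htm : t ≤ m / 64)
    {z : ℂ} (hz : z ≠ 0) :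
    lyap ω t (shearRot ω t z) + lyap ω t (shearRot ω (-t) z) ≤
      (2 - t ^ 2 / 3200) * lyap ω t z := by
  obtain ⟨r, hr, u, hu, rfl⟩ : ∃ r : ℝ, 0 < r ∧ ∃ u : ℂ, ‖u‖ = 1 ∧ z = r * u := by
    have hn := norm_ne_zero_iff.2 hz
    refine ⟨‖z‖, norm_pos_iff.2 hz, z / ‖z‖, ?_, ?_⟩
    · rw [norm_div, Complex.norm_real, norm_norm, div_self hn]
    · have : (‖z‖ : ℂ) ≠ 0 := by exact_mod_cast hn
      field_simp
  have hu0 : u ≠ 0 := by rintro rfl; simp at hu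
  have hdrift := corrLog_drift hω hm hm1 h2 h4 ht htm hu
  have hp := abs_le.1 (abs_corrLog_shearRot_sub_le hω hm hm1 h2 h4 ht htm (abs_of_pos ht) hu)
  have hn := abs_le.1 (abs_corrLog_shearRot_sub_le hω hm hm1 h2 h4 ht htm
    (r := -t) (by rw [abs_neg, abs_of_pos ht]) hu)
  set f := corrLog ω t u
  set x := corrLog ω t (shearRot ω t u) - f with hx
  set y := corrLog ω t (shearRot ω (-t) u) - f with hy
  have hexp : ∀ v : ℝ, -(5 * t) ≤ v ∧ v ≤ 5 * t →
      Real.exp (-(1 / 400) * v) ≤ 1 - 1 / 400 * v + 25 * t ^ 2 / 160000 := by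
    rintro v ⟨hv1, hv2⟩
    refine (exp_le_one_add_add_sq ?_).trans ?_
    · rw [abs_le]; constructor <;> linarith
    · nlinarith
  have hxe := hexp x hp
  have hye := hexp y hn
  simp only [lyap, shearRot_smul]
  rw [corrLog_smul ω t hr hu0, corrLog_smul ω t hr (shearRot_ne_zero hω _ hu0),
    corrLog_smul ω t hr (shearRot_ne_zero hω _ hu0)]
  have e1 : -(1 / 400) * (2 * Real.log r + corrLog ω t (shearRot ω t u)) =
      -(1 / 400) * (2 * Real.log r + f) + -(1 / 400) * x := by rw [hx]; ring
  have e2 : -(1 / 400) * (2 * Real.log r + corrLog ω t (shearRot ω (-t) u)) =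
      -(1 / 400) * (2 * Real.log r + f) + -(1 / 400) * y := by rw [hy]; ring
  rw [e1, e2, Real.exp_add, Real.exp_add, ← mul_add, mul_comm]
  refine mul_le_mul_of_nonneg_right ?_ (Real.exp_pos _).le
  linarith

lemma lyap_bounds (hm : 0 < m) (hm1 : m ≤ 1) (h2 : m ≤ ‖ω ^ 2 - 1‖) (h4 : m ≤ ‖ω ^ 4 - 1‖)
    (ht : 0 < t) (htm : t ≤ m / 64) {z : ℂ} (hz : z ≠ 0) :
    Real.exp (-1) * ‖z‖ ^ (-(1 / 200) : ℝ) ≤ lyap ω t z ∧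
      lyap ω t z ≤ Real.exp 1 * ‖z‖ ^ (-(1 / 200) : ℝ) := by
  have hc : |t ^ 2 * corrector ω z| ≤ 1 := by
    rw [abs_mul, abs_of_nonneg (sq_nonneg t)]
    refine (mul_le_mul_of_nonneg_left (abs_corrector_le hm h2 h4 hz) (sq_nonneg t)).trans ?_
    rw [mul_one_div, div_le_one hm]; nlinarith
  have hc' := abs_le.1 hc
  rw [Real.rpow_def_of_pos (norm_pos_iff.2 hz), ← Real.exp_add, ← Real.exp_add]
  simp only [lyap, corrLog]
  constructor <;> refine Real.exp_le_exp.2 ?_ <;> linarith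

/-- A potential on pairs of vectors dominating a power of the sine of their angle. -/
def pairPot (ω : ℂ) (t : ℝ) (z w : ℂ) : ℝ :=
  cross z w ^ (1 / 400 : ℝ) * ((lyap ω t z + lyap ω t w) / 2)

lemma pairPot_contract (hω : ‖ω‖ = 1) (hm : 0 < m) (hm1 : m ≤ 1)
    (h2 : m ≤ ‖ω ^ 2 - 1‖) (h4 : m ≤ ‖ω ^ 4 - 1‖) (ht : 0 < t) (htm : t ≤ m / 64)
    {z w : ℂ} (hz : z ≠ 0) (hw : w ≠ 0) (hzw : 0 ≤ cross z w) :
    pairPot ω t (shearRot ω t z) (shearRot ω t w) +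
      pairPot ω t (shearRot ω (-t) z) (shearRot ω (-t) w) ≤
      (2 - t ^ 2 / 3200) * pairPot ω t z w := by
  simp only [pairPot, cross_shearRot hω]
  have h1 := lyap_contract hω hm hm1 h2 h4 ht htm hz
  have h2 := lyap_contract hω hm hm1 h2 h4 ht htm hw
  have := mul_le_mul_of_nonneg_left (add_le_add h1 h2)
    (Real.rpow_nonneg hzw (1 / 400))
  linarith

lemma pairPot_nonneg {z w : ℂ} (hzw : 0 ≤ cross z w) : 0 ≤ pairPot ω t z w := by
  unfold pairPot lyap
  have := Real.rpow_nonneg hzw (1 / 400)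
  positivity

lemma le_pairPot (hm : 0 < m) (hm1 : m ≤ 1) (h2 : m ≤ ‖ω ^ 2 - 1‖) (h4 : m ≤ ‖ω ^ 4 - 1‖)
    (ht : 0 < t) (htm : t ≤ m / 64) {z w : ℂ} (hz : z ≠ 0) (hw : w ≠ 0) (hzw : 0 ≤ cross z w) :
    Real.exp (-1) * (cross z w / (‖z‖ * ‖w‖)) ^ (1 / 400 : ℝ) ≤ pairPot ω t z w := by
  have hz' := norm_pos_iff.2 hz
  have hw' := norm_pos_iff.2 hw
  have hbz := (lyap_bounds hm hm1 h2 h4 ht htm hz).1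
  have hbw := (lyap_bounds hm hm1 h2 h4 ht htm hw).1
  have hsq : ∀ {x : ℝ}, 0 < x → x ^ (-(1 / 200) : ℝ) = (x ^ (-(1 / 400) : ℝ)) ^ 2 := by
    intro x hx
    rw [← Real.rpow_natCast, ← Real.rpow_mul hx.le]; norm_num
  rw [hsq hz'] at hbz
  rw [hsq hw'] at hbw
  rw [div_eq_mul_inv, Real.mul_rpow hzw (by positivity), ← Real.rpow_neg_eq_inv_rpow,
    Real.mul_rpow hz'.le hw'.le, pairPot]
  set x := ‖z‖ ^ (-(1 / 400) : ℝ)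
  set y := ‖w‖ ^ (-(1 / 400) : ℝ)
  have hamgm : Real.exp (-1) * (x * y) ≤ (lyap ω t z + lyap ω t w) / 2 := by
    nlinarith [mul_nonneg (Real.exp_pos (-1)).le (sq_nonneg (x - y))]
  calc _ = cross z w ^ (1 / 400 : ℝ) * (Real.exp (-1) * (x * y)) := by ring
    _ ≤ _ := mul_le_mul_of_nonneg_left hamgm (Real.rpow_nonneg hzw _)

end Lyapunov

section Circle

/-- The image in the plane of the unit vector at angle `θ` under the linear change of coordinates
`(x, y) ↦ x - ω y`, which conjugates the unperturbed transfer matrix to a rotation. -/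
def zeta (ω : ℂ) (θ : AddCircle (2 * Real.pi)) : ℂ :=
  (Real.Angle.cos θ : ℂ) - ω * (Real.Angle.sin θ : ℂ)

lemma zeta_coe (ω : ℂ) (x : ℝ) :
    zeta ω (x : AddCircle (2 * Real.pi)) = (Real.cos x : ℂ) - ω * (Real.sin x : ℂ) := by
  change ((Real.Angle.cos (x : Real.Angle) : ℝ) : ℂ) -
    ω * ((Real.Angle.sin (x : Real.Angle) : ℝ) : ℂ) = _
  rw [Real.Angle.cos_coe, Real.Angle.sin_coe]

lemma continuous_zeta (ω : ℂ) : Continuous (zeta ω) := by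
  have hc : Continuous fun θ : AddCircle (2 * Real.pi) => Real.Angle.cos θ :=
    Real.Angle.continuous_cos
  have hs : Continuous fun θ : AddCircle (2 * Real.pi) => Real.Angle.sin θ :=
    Real.Angle.continuous_sin
  exact (Complex.continuous_ofReal.comp hc).sub
    (continuous_const.mul (Complex.continuous_ofReal.comp hs))

lemma continuous_cross_zeta (ω z : ℂ) : Continuous fun θ => cross z (zeta ω θ) := by
  have h := continuous_zeta ω
  exact (continuous_const.mul (Complex.continuous_im.comp h)).sub
    (continuous_const.mul (Complex.continuous_re.comp h))

lemma cross_zeta_tauMap {ω : ℂ} (hω : ‖ω‖ = 1) (him : ω.im ≠ 0) (lam x : ℝ)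
    (θ : AddCircle (2 * Real.pi)) :
    ∃ k : ℝ, 0 < k ∧ ∀ z : ℂ, cross (shearRot ω (x * (lam / -ω.im)) z) (zeta ω θ) =
      k * cross z (zeta ω (tauMap (gE lam (2 * ω.re) x) θ)) := by
  obtain ⟨y, hy, rfl⟩ : ∃ y ∈ Set.Ico 0 (0 + 2 * Real.pi), (y : AddCircle (2 * Real.pi)) = θ := by
    have := AddCircle.coe_image_Ico_eq (2 * Real.pi) 0
    have hθ : θ ∈ QuotientAddGroup.mk '' Set.Ico 0 (0 + 2 * Real.pi) := by rw [this]; trivial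
    exact hθ
  have hn := dot_self_of_norm_one hω
  set c := Real.cos y with hc
  set s := Real.sin y with hs
  have hcs : s ^ 2 + c ^ 2 = 1 := Real.sin_sq_add_cos_sq y
  set v : ℂ := ⟨(2 * ω.re - lam * x) * c - s, c⟩ with hv
  have hv0 : v ≠ 0 := by
    intro h
    have h1 : c = 0 := congrArg Complex.im h
    have h2 : (2 * ω.re - lam * x) * c - s = 0 := congrArg Complex.re h
    rw [h1] at h2 hcs
    have h3 : s = 0 := by linarith
    rw [h3] at hcs; norm_num at hcs
  have hvn := norm_pos_iff.2 hv0
  have htau : tauMap (gE lam (2 * ω.re) x) (y : AddCircle (2 * Real.pi)) =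
      ((Complex.arg v : ℝ) : AddCircle (2 * Real.pi)) := by
    rw [tauMap, AddCircle.liftIco_coe_apply hy, tauC]
    congr 2
    apply Complex.ext <;> simp [gE, hv, ← hc, ← hs]; ring
  refine ⟨‖v‖, hvn, fun z => ?_⟩
  rw [htau, zeta_coe, zeta_coe, Complex.cos_arg hv0, Complex.sin_arg, ← hc, ← hs]
  have hre : v.re = (2 * ω.re - lam * x) * c - s := rfl
  have himv : v.im = c := rfl
  obtain ⟨b, hb⟩ : ∃ b, lam / -ω.im = b := ⟨_, rfl⟩
  have hlam : lam = -(b * ω.im) := by rw [← hb]; field_simp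
  rw [hb]
  simp only [cross, shearRot, Complex.mul_re, Complex.mul_im, Complex.add_re, Complex.add_im,
    Complex.sub_re, Complex.sub_im, Complex.ofReal_re, Complex.ofReal_im, hre, himv]
  field_simp
  rw [hlam]
  linear_combination (s * z.im) * hn

end Circle

section Stationarity

variable {ω : ℂ} {t : ℝ} {ν : Measure (AddCircle (2 * Real.pi))}

/-- The open arc of directions between `z` and `w`. -/
def cone (ω z w : ℂ) : Set (AddCircle (2 * Real.pi)) :=
  {θ | 0 < cross z (zeta ω θ) ∧ cross w (zeta ω θ) < 0}

/-- The directions lying on the line spanned by `z`. -/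
def line (ω z : ℂ) : Set (AddCircle (2 * Real.pi)) :=
  {θ | cross z (zeta ω θ) = 0}

lemma measurableSet_cone (ω z w : ℂ) : MeasurableSet (cone ω z w) :=
  ((isOpen_lt continuous_const (continuous_cross_zeta ω z)).inter
    (isOpen_lt (continuous_cross_zeta ω w) continuous_const)).measurableSet

lemma measurableSet_line (ω z : ℂ) : MeasurableSet (line ω z) :=
  (isClosed_eq (continuous_cross_zeta ω z) continuous_const).measurableSet

lemma tauMap_preimage_cone (hω : ‖ω‖ = 1) (him : ω.im ≠ 0) (lam x : ℝ) (z w : ℂ) :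
    tauMap (gE lam (2 * ω.re) x) ⁻¹' cone ω z w =
      cone ω (shearRot ω (x * (lam / -ω.im)) z) (shearRot ω (x * (lam / -ω.im)) w) := by
  ext θ
  obtain ⟨k, hk, h⟩ := cross_zeta_tauMap hω him lam x θ
  have hneg : ∀ y : ℝ, k * y < 0 ↔ y < 0 := fun y => by
    rw [← neg_pos, ← mul_neg, mul_pos_iff_of_pos_left hk, neg_pos]
  simp only [cone, Set.mem_preimage, Set.mem_ofPred_eq, h, mul_pos_iff_of_pos_left hk, hneg]

lemma tauMap_preimage_line (hω : ‖ω‖ = 1) (him : ω.im ≠ 0) (lam x : ℝ) (z : ℂ) :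
    tauMap (gE lam (2 * ω.re) x) ⁻¹' line ω z =
      line ω (shearRot ω (x * (lam / -ω.im)) z) := by
  ext θ
  obtain ⟨k, hk, h⟩ := cross_zeta_tauMap hω him lam x θ
  simp only [line, Set.mem_preimage, Set.mem_ofPred_eq, h, mul_eq_zero, hk.ne', false_or]

lemma Stationary.real [IsProbabilityMeasure ν] {lam E : ℝ} (h : Stationary lam E ν)
    {s : Set (AddCircle (2 * Real.pi))} (hs : MeasurableSet s) :
    ν.real s = (ν.real (tauMap (gE lam E 1) ⁻¹' s) +
      ν.real (tauMap (gE lam E (-1)) ⁻¹' s)) / 2 := by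
  simp only [Measure.real]
  rw [h s hs, ENNReal.toReal_div, ENNReal.toReal_add (measure_ne_top _ _) (measure_ne_top _ _)]
  simp

lemma Stationary.real_cone [IsProbabilityMeasure ν] {lam : ℝ} (hω : ‖ω‖ = 1) (him : ω.im ≠ 0)
    (h : Stationary lam (2 * ω.re) ν) (z w : ℂ) :
    ν.real (cone ω z w) =
      (ν.real (cone ω (shearRot ω (lam / -ω.im) z) (shearRot ω (lam / -ω.im) w)) +
      ν.real (cone ω (shearRot ω (-(lam / -ω.im)) z) (shearRot ω (-(lam / -ω.im)) w))) / 2 := by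
  rw [h.real (measurableSet_cone ω z w), tauMap_preimage_cone hω him,
    tauMap_preimage_cone hω him, one_mul, neg_one_mul]

lemma Stationary.real_line [IsProbabilityMeasure ν] {lam : ℝ} (hω : ‖ω‖ = 1) (him : ω.im ≠ 0)
    (h : Stationary lam (2 * ω.re) ν) (z : ℂ) :
    ν.real (line ω z) =
      (ν.real (line ω (shearRot ω (lam / -ω.im) z)) +
      ν.real (line ω (shearRot ω (-(lam / -ω.im)) z))) / 2 := by
  rw [h.real (measurableSet_line ω z), tauMap_preimage_line hω him,
    tauMap_preimage_line hω him, one_mul, neg_one_mul]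

lemma exists_eq_smul_of_cross_eq_zero {z w : ℂ} (hz : z ≠ 0) (h : cross z w = 0) :
    ∃ c : ℝ, w = c * z := by
  have hz' : z.re * z.re + z.im * z.im ≠ 0 := by
    rw [← Complex.normSq_apply]; exact (Complex.normSq_pos.2 hz).ne'
  simp only [cross] at h
  refine ⟨dot z w / (z.re * z.re + z.im * z.im), ?_⟩
  apply Complex.ext
  · rw [Complex.re_ofReal_mul, dot, div_mul_eq_mul_div, eq_div_iff hz']
    linear_combination (-z.im) * h
  · rw [Complex.im_ofReal_mul, dot, div_mul_eq_mul_div, eq_div_iff hz']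
    linear_combination z.re * h

lemma line_smul {c : ℝ} (hc : c ≠ 0) (z : ℂ) : line ω (c * z) = line ω z := by
  ext θ
  have := cross_smul_smul c 1 z (zeta ω θ)
  simp only [Complex.ofReal_one, one_mul, mul_one] at this
  simp [line, this, hc]

lemma zeta_ne_zero (him : ω.im ≠ 0) (θ : AddCircle (2 * Real.pi)) : zeta ω θ ≠ 0 := by
  intro h
  obtain ⟨x, rfl⟩ := QuotientAddGroup.mk_surjective θ
  rw [show (QuotientAddGroup.mk x : AddCircle (2 * Real.pi)) = (x : AddCircle (2 * Real.pi))
    from rfl, zeta_coe] at h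
  have h1 := congrArg Complex.im h
  have h2 := congrArg Complex.re h
  simp only [Complex.sub_im, Complex.sub_re, Complex.ofReal_im, Complex.im_mul_ofReal,
    Complex.re_mul_ofReal, Complex.ofReal_re, Complex.zero_re, Complex.zero_im] at h1 h2
  have hs : Real.sin x = 0 := by
    rcases mul_eq_zero.1 (show ω.im * Real.sin x = 0 by linarith) with h | h
    · exact absurd h him
    · exact h
  have := Real.sin_sq_add_cos_sq x
  rw [hs] at h2 this
  have hc : Real.cos x = 0 := by linarith
  rw [hc] at this; norm_num at this

lemma cross_eq_zero_of_common {z w y : ℂ} (hy : y ≠ 0) (hz : cross z y = 0) (hw : cross w y = 0) :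
    cross z w = 0 := by
  have hz' : cross y z = 0 := by simp only [cross] at hz ⊢; linarith
  have hw' : cross y w = 0 := by simp only [cross] at hw ⊢; linarith
  obtain ⟨a, rfl⟩ := exists_eq_smul_of_cross_eq_zero hy hz'
  obtain ⟨b, rfl⟩ := exists_eq_smul_of_cross_eq_zero hy hw'
  rw [cross_smul_smul]; simp only [cross]; ring

lemma finite_setOf_le_real_line [IsProbabilityMeasure ν] (him : ω.im ≠ 0) {ι : Type*} {f : ι → ℂ}
    (hf : Pairwise fun i j => cross (f i) (f j) ≠ 0) {ε : ℝ} (hε : 0 < ε) :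
    {i | ε ≤ ν.real (line ω (f i))}.Finite := by
  have := Measure.finite_const_le_meas_of_disjoint_iUnion ν (ε := ENNReal.ofReal ε)
    (by simpa using hε) (As := fun i => line ω (f i)) (fun i => measurableSet_line ω _)
    (fun i j hij => Set.disjoint_left.2 fun θ h1 h2 =>
      hf hij (cross_eq_zero_of_common (zeta_ne_zero him θ) h1 h2)) (measure_ne_top _ _)
  refine this.subset fun i hi => ?_
  exact (ENNReal.ofReal_le_iff_le_toReal (measure_ne_top _ _)).2 hi

lemma Stationary.real_line_eq_zero [IsProbabilityMeasure ν] {lam : ℝ} (hlam : lam ≠ 0)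
    (hω : ‖ω‖ = 1) (him : ω.im ≠ 0) (h : Stationary lam (2 * ω.re) ν) {z : ℂ} (hz : z ≠ 0) :
    ν.real (line ω z) = 0 := by
  have hst := h.real_line hω him
  set t : ℝ := lam / -ω.im with ht
  have ht0 : t ≠ 0 := div_ne_zero hlam (neg_ne_zero.2 him)
  have hω0 : ω ≠ 0 := by rintro rfl; simp at hω
  have hn := dot_self_of_norm_one hω
  let ℓ : ℝ → ℂ := fun s => ω * (s + Complex.I)
  have hℓ : ∀ s s', cross (ℓ s) (ℓ s') = s - s' := by
    intro s s'
    simp only [ℓ, cross, Complex.mul_re, Complex.mul_im, Complex.add_re, Complex.add_im,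
      Complex.ofReal_re, Complex.ofReal_im, Complex.I_re, Complex.I_im]
    linear_combination (s - s') * hn
  have hℓp : Pairwise fun s s' => cross (ℓ s) (ℓ s') ≠ 0 := fun s s' hss => by
    change cross (ℓ s) (ℓ s') ≠ 0
    rw [hℓ]; exact sub_ne_zero.2 hss
  have hℓ0 : ∀ s, ℓ s ≠ 0 := fun s hs => by
    have h1 := hℓ s (s - 1)
    rw [hs] at h1; simp [cross] at h1
  have hcover : ∀ y : ℂ, y ≠ 0 → (∃ c s : ℝ, c ≠ 0 ∧ y = c * ℓ s) ∨
      ∃ c : ℝ, c ≠ 0 ∧ y = c * ω := by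
    intro y hy
    obtain ⟨x, rfl⟩ : ∃ x, y = ω * x := ⟨y / ω, by field_simp⟩
    have hx : x ≠ 0 := right_ne_zero_of_mul hy
    by_cases hxi : x.im = 0
    · right
      refine ⟨x.re, fun hre => hx (Complex.ext hre hxi), ?_⟩
      rw [mul_comm]; congr 1; exact Complex.ext rfl (by simpa using hxi)
    · left
      refine ⟨x.im, x.re / x.im, hxi, ?_⟩
      have hxi' : (x.im : ℂ) ≠ 0 := by exact_mod_cast hxi
      simp only [ℓ]
      conv_lhs => rw [← Complex.re_add_im x]
      push_cast; field_simp
  have hshear : ∀ r : ℝ, r ≠ 0 → ∃ c s : ℝ, c ≠ 0 ∧ shearRot ω r ω = c * ℓ s := by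
    intro r hr
    refine ⟨ω.im, (ω.re + r * ω.im) / ω.im, him, ?_⟩
    have hi' : (ω.im : ℂ) ≠ 0 := by exact_mod_cast him
    simp only [ℓ, shearRot]
    nth_rewrite 2 [← Complex.re_add_im ω]
    push_cast; field_simp; ring
  by_contra hne
  have hpos : ∀ y, 0 ≤ ν.real (line ω y) := fun y => measureReal_nonneg
  -- a line of positive mass of the form `ℓ s`
  have hω_le : ∃ s, ν.real (line ω ω) ≤ ν.real (line ω (ℓ s)) := by
    obtain ⟨c₁, s₁, hc₁, e₁⟩ := hshear t ht0
    obtain ⟨c₂, s₂, hc₂, e₂⟩ := hshear (-t) (neg_ne_zero.2 ht0)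
    have := hst ω
    rw [e₁, e₂, line_smul hc₁, line_smul hc₂] at this
    rcases le_total (ν.real (line ω (ℓ s₁))) (ν.real (line ω (ℓ s₂))) with h' | h'
    · exact ⟨s₂, by linarith⟩
    · exact ⟨s₁, by linarith⟩
  have hdom : ∀ y, y ≠ 0 → ∃ s, ν.real (line ω y) ≤ ν.real (line ω (ℓ s)) := by
    intro y hy
    rcases hcover y hy with ⟨c, s, hc, rfl⟩ | ⟨c, hc, rfl⟩
    · exact ⟨s, by rw [line_smul hc]⟩
    · rw [line_smul hc]; exact hω_le
  obtain ⟨s₀, hs₀⟩ := hdom z hz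
  have hzpos : 0 < ν.real (line ω z) := lt_of_le_of_ne (hpos z) (Ne.symm hne)
  obtain ⟨s₁, hs₁, hmax⟩ := Set.exists_max_image _ (fun s => ν.real (line ω (ℓ s)))
    (finite_setOf_le_real_line (ν := ν) him hℓp hzpos) ⟨s₀, hs₀⟩
  set M := ν.real (line ω (ℓ s₁)) with hM
  have hMpos : 0 < M := lt_of_lt_of_le hzpos hs₁
  have hle : ∀ y, y ≠ 0 → ν.real (line ω y) ≤ M := by
    intro y hy
    obtain ⟨s, hs⟩ := hdom y hy
    refine hs.trans ?_
    by_cases hsz : ν.real (line ω z) ≤ ν.real (line ω (ℓ s))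
    · exact hmax s hsz
    · exact (not_le.1 hsz).le.trans hs₁
  have hstep : ∀ y, y ≠ 0 → ν.real (line ω y) = M →
      ν.real (line ω (shearRot ω t y)) = M ∧ ν.real (line ω (shearRot ω (-t) y)) = M := by
    intro y hy hyM
    have h1 := hle _ (shearRot_ne_zero hω t hy)
    have h2 := hle _ (shearRot_ne_zero hω (-t) hy)
    have h3 := hst y
    constructor <;> linarith
  have hback : ∀ y, y ≠ 0 → ν.real (line ω y) = M →
      ∃ x, x ≠ 0 ∧ ν.real (line ω x) = M ∧ ∃ c : ℝ, shearRot ω t x = c * y := by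
    intro y hy hyM
    have hit : ∀ n : ℕ, (shearRot ω t)^[n] y ≠ 0 ∧ ν.real (line ω ((shearRot ω t)^[n] y)) = M := by
      intro n
      induction n with
      | zero => exact ⟨hy, hyM⟩
      | succ n ih =>
        rw [Function.iterate_succ_apply']
        exact ⟨shearRot_ne_zero hω t ih.1, (hstep _ ih.1 ih.2).1⟩
    have hcr : ∀ n : ℕ, ∀ u v, cross ((shearRot ω t)^[n] u) ((shearRot ω t)^[n] v) = cross u v := by
      intro n
      induction n with
      | zero => intro u v; rfl
      | succ n ih =>
        intro u v
        rw [Function.iterate_succ_apply, Function.iterate_succ_apply, ih, cross_shearRot hω]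
    have hreturn : ∃ k : ℕ, cross y ((shearRot ω t)^[k + 1] y) = 0 := by
      by_contra! hno
      have hlt : ∀ i k : ℕ,
          cross ((shearRot ω t)^[i] y) ((shearRot ω t)^[i + (k + 1)] y) ≠ 0 := by
        intro i k
        rw [Function.iterate_add_apply, hcr]; exact hno k
      have hp : Pairwise fun i j : ℕ =>
          cross ((shearRot ω t)^[i] y) ((shearRot ω t)^[j] y) ≠ 0 := by
        intro i j hij
        rcases lt_or_gt_of_ne hij with h' | h'
        · obtain ⟨k, rfl⟩ := Nat.exists_eq_add_of_lt h'
          exact hlt i k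
        · obtain ⟨k, rfl⟩ := Nat.exists_eq_add_of_lt h'
          intro h0
          refine hlt j k ?_
          rw [← add_assoc]
          simp only [cross] at h0 ⊢; linarith
      have hfin := finite_setOf_le_real_line (ν := ν) him hp hMpos
      refine Set.infinite_univ (hfin.subset fun n _ => ?_)
      exact (hit n).2.ge
    obtain ⟨k, hk⟩ := hreturn
    rw [Function.iterate_succ_apply'] at hk
    exact ⟨_, (hit k).1, (hit k).2, exists_eq_smul_of_cross_eq_zero hy hk⟩
  have hback_shear : ∀ s, ν.real (line ω (ℓ s)) = M → ν.real (line ω (ℓ (s - 2 * t))) = M := by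
    intro s hs
    obtain ⟨x, hx, hxM, c, hc⟩ := hback _ (hℓ0 s) hs
    have hc0 : c ≠ 0 := by
      rintro rfl
      exact shearRot_ne_zero hω t hx (by simpa using hc)
    have hxc : x + (t * x.im : ℝ) = c * (s + Complex.I) := by
      refine mul_left_cancel₀ hω0 ?_
      rw [show ω * (c * (s + Complex.I)) = c * ℓ s by simp only [ℓ]; ring, ← hc, shearRot]
    have hxi : x.im = c := by simpa using congrArg Complex.im hxc
    have : shearRot ω (-t) x = c * ℓ (s - 2 * t) := by
      simp only [shearRot, ℓ]
      rw [show x = c * (s + Complex.I) - (t * x.im : ℝ) by rw [← hxc]; ring]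
      rw [hxi]
      simp
      ring
    rw [← line_smul hc0, ← this]
    exact (hstep x hx hxM).2
  have hfin := finite_setOf_le_real_line (ν := ν) him hℓp hMpos
  have hall : ∀ n : ℕ, ν.real (line ω (ℓ (s₁ - 2 * t * n))) = M := by
    intro n
    induction n with
    | zero => simp [hM]
    | succ n ih =>
      have := hback_shear _ ih
      rw [show s₁ - 2 * t * n - 2 * t = s₁ - 2 * t * ((n + 1 : ℕ) : ℝ) by push_cast; ring] at this
      exact this
  refine Set.infinite_range_of_injective (f := fun n : ℕ => s₁ - 2 * t * n) ?_
    (hfin.subset ?_)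
  · intro a b hab
    simpa [ht0] using hab
  · rintro _ ⟨n, rfl⟩
    exact (hall n).ge

end Stationarity

section SmallCones

variable {ω : ℂ} {t : ℝ} {ν : Measure (AddCircle (2 * Real.pi))}

lemma cone_smul {a b : ℝ} (ha : 0 < a) (hb : 0 < b) (z w : ℂ) :
    cone ω (a * z) (b * w) = cone ω z w := by
  ext θ
  have h1 := cross_smul_smul a 1 z (zeta ω θ)
  have h2 := cross_smul_smul b 1 w (zeta ω θ)
  simp only [Complex.ofReal_one, one_mul, mul_one] at h1 h2
  have hneg : ∀ y : ℝ, b * y < 0 ↔ y < 0 := fun y => by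
    rw [← neg_pos, ← mul_neg, mul_pos_iff_of_pos_left hb, neg_pos]
  simp only [cone, Set.mem_ofPred_eq, h1, h2, mul_pos_iff_of_pos_left ha, hneg]

lemma norm_sub_lt_of_mem_sector {z w a : ℂ} (hz : ‖z‖ = 1) (hw : ‖w‖ = 1) (ha : ‖a‖ = 1)
    (hdot : 0 < dot z w) (hpos : 0 < cross z w) {r : ℝ}
    (hcross : cross z w < r) (hza : 0 < cross z a) (hwa : cross w a < 0) : ‖a - z‖ < 2 * r := by
  have h1 := cross_sq_add_dot_sq z w
  have h2 := cross_sq_add_dot_sq z a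
  rw [hz, hw] at h1
  rw [hz, ha] at h2
  have hz2 := dot_self_of_norm_one hz
  -- the sine and cosine addition formulas for the angle from `a` to `w`
  have hsub : cross w a = dot z w * cross z a - cross z w * dot z a := by
    simp only [cross, dot]
    linear_combination (-(w.re * a.im - w.im * a.re)) * hz2
  have hprod : 0 < dot z w * cross z a := mul_pos hdot hza
  have hzw : dot z w * cross z a < cross z w * dot z a := by linarith
  have hda : 0 < dot z a := pos_of_mul_pos_right (hprod.trans hzw) hpos.le
  have hsq : cross z a ^ 2 < cross z w ^ 2 := by
    have := mul_self_lt_mul_self hprod.le hzw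
    have e1 : dot z w ^ 2 = 1 - cross z w ^ 2 := by linarith
    have e2 : dot z a ^ 2 = 1 - cross z a ^ 2 := by linarith
    have e3 : dot z w ^ 2 * cross z a ^ 2 < cross z w ^ 2 * dot z a ^ 2 := by linarith
    rw [e1, e2] at e3
    linarith
  have hnorm : ‖a - z‖ ^ 2 = 2 - 2 * dot z a := by
    have ha2 := dot_self_of_norm_one ha
    rw [norm_sq_eq_dot]
    simp only [dot, Complex.sub_re, Complex.sub_im]
    linarith
  have hd1 : dot z a ≤ 1 := by nlinarith [sq_nonneg (cross z a)]
  refine lt_of_pow_lt_pow_left₀ 2 (by linarith) ?_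
  rw [hnorm]
  nlinarith

lemma exists_pos_real_cone_le [IsProbabilityMeasure ν] (him : ω.im ≠ 0)
    (hline : ∀ z : ℂ, z ≠ 0 → ν.real (line ω z) = 0) {ε : ℝ} (hε : 0 < ε) :
    ∃ r : ℝ, 0 < r ∧ ∀ z w : ℂ, z ≠ 0 → w ≠ 0 → 0 < dot z w → 0 < cross z w →
      cross z w / (‖z‖ * ‖w‖) < r → ν.real (cone ω z w) ≤ ε := by
  let dir : AddCircle (2 * Real.pi) → ℂ := fun θ => zeta ω θ / ‖zeta ω θ‖
  have hnorm : ∀ θ, ‖zeta ω θ‖ ≠ 0 := fun θ => norm_ne_zero_iff.2 (zeta_ne_zero him θ)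
  have hdir1 : ∀ θ, ‖dir θ‖ = 1 := fun θ => by
    simp only [dir]; rw [norm_div, Complex.norm_real, norm_norm, div_self (hnorm θ)]
  have hdirc : Continuous dir := (continuous_zeta ω).div
    (Complex.continuous_ofReal.comp (continuous_zeta ω).norm)
    fun θ => by exact_mod_cast hnorm θ
  have hzeta : ∀ θ, zeta ω θ = ((‖zeta ω θ‖ : ℝ) : ℂ) * dir θ := fun θ => by
    have : (‖zeta ω θ‖ : ℂ) ≠ 0 := by exact_mod_cast hnorm θ
    simp only [dir]; field_simp
  have hcrossdir : ∀ z θ, cross z (zeta ω θ) = ‖zeta ω θ‖ * cross z (dir θ) := fun z θ => by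
    have := cross_smul_smul 1 ‖zeta ω θ‖ z (dir θ)
    rw [← hzeta] at this; simpa using this
  have hopen : ∀ a : ℂ, ‖a‖ = 1 →
      ∃ U, a ∈ U ∧ IsOpen U ∧ ν.map dir U < ENNReal.ofReal ε := by
    intro a ha
    have ha0 : a ≠ 0 := by rintro rfl; simp at ha
    have hsing : ν.map dir {a} = 0 := by
      rw [Measure.map_apply hdirc.measurable (measurableSet_singleton a)]
      have h0 : ν (line ω a) = 0 := (measureReal_eq_zero_iff).1 (hline a ha0)
      refine measure_mono_null (fun θ hθ => ?_) h0
      have hθ' : dir θ = a := hθ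
      change cross a (zeta ω θ) = 0
      rw [hcrossdir, hθ']; simp only [cross]; ring
    have : IsFiniteMeasure (ν.map dir) := inferInstance
    obtain ⟨U, hU, hUo, hUε⟩ := Set.exists_isOpen_lt_of_lt (μ := ν.map dir) {a} (ENNReal.ofReal ε)
      (by simpa [hsing] using hε)
    exact ⟨U, hU rfl, hUo, hUε⟩
  choose! U hUmem hUo hUε using hopen
  obtain ⟨δ, hδ, hleb⟩ := lebesgue_number_lemma_of_metric (s := Metric.sphere (0 : ℂ) 1)
    (c := fun a : Metric.sphere (0 : ℂ) 1 => U a) (isCompact_sphere _ _)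
    (fun a => hUo a (mem_sphere_zero_iff_norm.1 a.2))
    (fun a ha => Set.mem_iUnion.2 ⟨⟨a, ha⟩, hUmem a (by simpa using ha)⟩)
  refine ⟨δ / 2, half_pos hδ, fun z w hz hw hdot hpos hcross => ?_⟩
  have hz' := norm_pos_iff.2 hz
  have hw' := norm_pos_iff.2 hw
  have hunit : ∀ v : ℂ, v ≠ 0 → ‖((‖v‖⁻¹ : ℝ) : ℂ) * v‖ = 1 := fun v hv => by
    rw [norm_mul, Complex.norm_real, Real.norm_of_nonneg (by positivity),
      inv_mul_cancel₀ (norm_ne_zero_iff.2 hv)]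
  rw [← cone_smul (inv_pos.2 hz') (inv_pos.2 hw')]
  have hdot' : 0 < dot (((‖z‖⁻¹ : ℝ) : ℂ) * z) (((‖w‖⁻¹ : ℝ) : ℂ) * w) := by
    have : dot (((‖z‖⁻¹ : ℝ) : ℂ) * z) (((‖w‖⁻¹ : ℝ) : ℂ) * w) = ‖z‖⁻¹ * ‖w‖⁻¹ * dot z w := by
      simp only [dot, Complex.re_ofReal_mul, Complex.im_ofReal_mul]; ring
    rw [this]; positivity
  have hcross' : cross (((‖z‖⁻¹ : ℝ) : ℂ) * z) (((‖w‖⁻¹ : ℝ) : ℂ) * w) < δ / 2 := by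
    rw [cross_smul_smul, ← mul_inv, inv_mul_eq_div]; exact hcross
  have hpos' : 0 < cross (((‖z‖⁻¹ : ℝ) : ℂ) * z) (((‖w‖⁻¹ : ℝ) : ℂ) * w) := by
    rw [cross_smul_smul]; positivity
  have hzu := hunit z hz
  have hwu := hunit w hw
  set z' := ((‖z‖⁻¹ : ℝ) : ℂ) * z
  set w' := ((‖w‖⁻¹ : ℝ) : ℂ) * w
  obtain ⟨a, ha⟩ := hleb z' (by simpa using hzu)
  have hsub : cone ω z' w' ⊆ dir ⁻¹' (U a) := by
    rintro θ ⟨h1, h2⟩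
    rw [hcrossdir] at h1 h2
    have hp := norm_pos_iff.2 (zeta_ne_zero him θ)
    refine ha ?_
    rw [Metric.mem_ball, dist_eq_norm]
    have := norm_sub_lt_of_mem_sector hzu hwu (hdir1 θ) hdot' hpos' hcross'
      (pos_of_mul_pos_right h1 hp.le) (by nlinarith)
    linarith
  refine ENNReal.toReal_le_of_le_ofReal hε.le ((measure_mono hsub).trans ?_)
  rw [← Measure.map_apply hdirc.measurable (hUo a (mem_sphere_zero_iff_norm.1 a.2)).measurableSet]
  exact (hUε a (mem_sphere_zero_iff_norm.1 a.2)).le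

end SmallCones

section Decay

variable {ω : ℂ} {m t : ℝ} {ν : Measure (AddCircle (2 * Real.pi))}

lemma dot_shearRot_pos (hω : ‖ω‖ = 1) {r : ℝ} (hr : |r| ≤ 1 / 64) {z w : ℂ} (hz : z ≠ 0)
    (hw : w ≠ 0) (hdot : 0 < dot z w) (hcross : |cross z w| ≤ ‖z‖ * ‖w‖ / 2) :
    0 < dot (shearRot ω r z) (shearRot ω r w) := by
  have hP : 0 < ‖z‖ * ‖w‖ := mul_pos (norm_pos_iff.2 hz) (norm_pos_iff.2 hw)
  have hsq := cross_sq_add_dot_sq z w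
  set P := ‖z‖ * ‖w‖
  have hd : P / 2 ≤ dot z w := by
    rw [← sq_abs] at hsq
    nlinarith [abs_nonneg (cross z w)]
  have hmul : ∀ a b : ℝ, |a| ≤ ‖z‖ → |b| ≤ ‖w‖ → |a * b| ≤ P := fun a b ha hb => by
    rw [abs_mul]; exact mul_le_mul ha hb (abs_nonneg _) (norm_nonneg _)
  have h1 := hmul _ _ (Complex.abs_im_le_norm z) (Complex.abs_re_le_norm w)
  have h2 := hmul _ _ (Complex.abs_re_le_norm z) (Complex.abs_im_le_norm w)
  have h3 := hmul _ _ (Complex.abs_im_le_norm z) (Complex.abs_im_le_norm w)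
  have h12 : |r * (z.im * w.re + z.re * w.im)| ≤ 1 / 64 * (2 * P) := by
    rw [abs_mul]
    exact mul_le_mul hr ((abs_add_le _ _).trans (by linarith)) (abs_nonneg _) (by norm_num)
  have h33 : |r ^ 2 * (z.im * w.im)| ≤ 1 / 64 * P := by
    rw [abs_mul, abs_pow]
    refine mul_le_mul ?_ h3 (abs_nonneg _) (by norm_num)
    nlinarith [abs_nonneg r]
  rw [dot_shearRot hω]
  linarith [(abs_le.1 h12).1, (abs_le.1 h33).1]

/-- The measure of a cone is bounded by the pair potential of its sides. -/
lemma Stationary.real_cone_le [IsProbabilityMeasure ν] {lam : ℝ} (hlam : lam ≠ 0)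
    (hω : ‖ω‖ = 1) (him : ω.im ≠ 0) (h : Stationary lam (2 * ω.re) ν) (hm : 0 < m) (hm1 : m ≤ 1)
    (h2 : m ≤ ‖ω ^ 2 - 1‖) (h4 : m ≤ ‖ω ^ 4 - 1‖) (htlam : lam / -ω.im = t) (ht : 0 < t)
    (htm : t ≤ m / 64) {z w : ℂ} (hz : z ≠ 0) (hw : w ≠ 0) (hdot : 0 < dot z w)
    (hcross : 0 < cross z w) :
    ν.real (cone ω z w) ≤ Real.exp 1 * 2 ^ (1 / 400 : ℝ) * pairPot ω t z w := by
  set K : ℝ := Real.exp 1 * 2 ^ (1 / 400 : ℝ) with hK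
  have hst := h.real_cone hω him
  rw [htlam] at hst
  have ht64 : t ≤ 1 / 64 := by linarith
  refine le_of_forall_pos_le_add fun ε hε => ?_
  obtain ⟨r, hr, hsmall⟩ := exists_pos_real_cone_le him
    (fun z hz => h.real_line_eq_zero hlam hω him hz) hε
  set L : ℝ := Real.exp 1 * (r ^ (1 / 400 : ℝ))⁻¹ with hL
  set q : ℝ := 1 - t ^ 2 / 6400 with hq
  have hq0 : 0 ≤ q := by rw [hq]; nlinarith
  have hq1 : q < 1 := by rw [hq]; nlinarith [sq_pos_of_pos ht]
  have hK0 : 0 ≤ K := by positivity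
  have hL0 : 0 ≤ L := by positivity
  have hlarge : ∀ x : ℝ, 0 < x → ∀ z w : ℂ, z ≠ 0 → w ≠ 0 → 0 < cross z w →
      x ≤ cross z w / (‖z‖ * ‖w‖) → 1 ≤ Real.exp 1 * (x ^ (1 / 400 : ℝ))⁻¹ * pairPot ω t z w := by
    intro x hx z w hz hw hzw hxr
    have hp := le_pairPot hm hm1 h2 h4 ht htm hz hw hzw.le
    have hx' := Real.rpow_le_rpow hx.le hxr (show (0 : ℝ) ≤ 1 / 400 by norm_num)
    have hxp : 0 < x ^ (1 / 400 : ℝ) := Real.rpow_pos_of_pos hx _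
    have hexp : Real.exp 1 * Real.exp (-1) = 1 := by rw [← Real.exp_add]; simp
    calc (1 : ℝ) = Real.exp 1 * (x ^ (1 / 400 : ℝ))⁻¹ * (Real.exp (-1) * x ^ (1 / 400 : ℝ)) := by
          field_simp; linarith
      _ ≤ _ := by gcongr; exact (mul_le_mul_of_nonneg_left hx' (Real.exp_pos _).le).trans hp
  have hind : ∀ n : ℕ, ∀ z w : ℂ, z ≠ 0 → w ≠ 0 → 0 < dot z w → 0 < cross z w →
      ν.real (cone ω z w) ≤ K * pairPot ω t z w + ε + q ^ n * (L * pairPot ω t z w) := by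
    intro n
    induction n with
    | zero =>
      intro z w hz hw hdot hzw
      have hp := pairPot_nonneg (ω := ω) (t := t) hzw.le
      rw [pow_zero, one_mul]
      by_cases hcase : cross z w / (‖z‖ * ‖w‖) < r
      · have := hsmall z w hz hw hdot hzw hcase
        nlinarith [mul_nonneg hK0 hp, mul_nonneg hL0 hp]
      · have := hlarge r hr z w hz hw hzw (not_lt.1 hcase)
        have h1 : ν.real (cone ω z w) ≤ 1 := measureReal_le_one
        nlinarith [mul_nonneg hK0 hp]
    | succ n ih =>
      intro z w hz hw hdot hzw
      have hp := pairPot_nonneg (ω := ω) (t := t) hzw.le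
      by_cases hcase : cross z w / (‖z‖ * ‖w‖) < 1 / 2
      · have hP : 0 < ‖z‖ * ‖w‖ := mul_pos (norm_pos_iff.2 hz) (norm_pos_iff.2 hw)
        have hc : |cross z w| ≤ ‖z‖ * ‖w‖ / 2 := by
          rw [abs_of_pos hzw]; rw [div_lt_iff₀ hP] at hcase; linarith
        have hcontr := pairPot_contract hω hm hm1 h2 h4 ht htm hz hw hzw.le
        have ih1 := ih (shearRot ω t z) (shearRot ω t w) (shearRot_ne_zero hω t hz)
          (shearRot_ne_zero hω t hw)
          (dot_shearRot_pos hω (by rw [abs_of_pos ht]; exact ht64) hz hw hdot hc)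
          (by rw [cross_shearRot hω]; exact hzw)
        have ih2 := ih (shearRot ω (-t) z) (shearRot ω (-t) w) (shearRot_ne_zero hω _ hz)
          (shearRot_ne_zero hω _ hw)
          (dot_shearRot_pos hω (by rw [abs_neg, abs_of_pos ht]; exact ht64) hz hw hdot hc)
          (by rw [cross_shearRot hω]; exact hzw)
        rw [hst z w]
        set p₁ := pairPot ω t (shearRot ω t z) (shearRot ω t w)
        set p₂ := pairPot ω t (shearRot ω (-t) z) (shearRot ω (-t) w)
        set p := pairPot ω t z w
        have hsum : (p₁ + p₂) / 2 ≤ q * p := by rw [hq]; linarith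
        have hqp : q * p ≤ p := mul_le_of_le_one_left hp hq1.le
        have e1 := mul_le_mul_of_nonneg_left (hsum.trans hqp) hK0
        have e2 := mul_le_mul_of_nonneg_left hsum (mul_nonneg (pow_nonneg hq0 n) hL0)
        calc _ ≤ K * ((p₁ + p₂) / 2) + ε + q ^ n * L * ((p₁ + p₂) / 2) := by linarith
          _ ≤ K * p + ε + q ^ n * L * (q * p) := by linarith
          _ = _ := by ring
      · have := hlarge (1 / 2) (by norm_num) z w hz hw hzw (not_lt.1 hcase)
        rw [one_div (2 : ℝ), Real.inv_rpow (by norm_num), inv_inv, ← hK] at this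
        have h1 : ν.real (cone ω z w) ≤ 1 := measureReal_le_one
        have : 0 ≤ q ^ (n + 1) * (L * pairPot ω t z w) := by positivity
        linarith
  have hlim : Filter.Tendsto
      (fun n : ℕ => K * pairPot ω t z w + ε + q ^ n * (L * pairPot ω t z w)) Filter.atTop
      (nhds (K * pairPot ω t z w + ε + 0 * (L * pairPot ω t z w))) :=
    ((tendsto_pow_atTop_nhds_zero_of_lt_one hq0 hq1).mul_const _).const_add _
  rw [zero_mul, add_zero] at hlim
  exact ge_of_tendsto' hlim fun n => hind n z w hz hw hdot hcross

end Decay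

section Arcs

lemma cross_zeta_coe (ω : ℂ) (a b : ℝ) :
    cross (zeta ω (a : AddCircle (2 * Real.pi))) (zeta ω (b : AddCircle (2 * Real.pi))) =
      -ω.im * Real.sin (b - a) := by
  rw [zeta_coe, zeta_coe, Real.sin_sub]
  simp only [cross, Complex.sub_re, Complex.sub_im, Complex.ofReal_re, Complex.ofReal_im,
    Complex.re_mul_ofReal, Complex.im_mul_ofReal]
  ring

lemma dot_zeta_coe {ω : ℂ} (hω : ‖ω‖ = 1) (a b : ℝ) :
    dot (zeta ω (a : AddCircle (2 * Real.pi))) (zeta ω (b : AddCircle (2 * Real.pi))) =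
      Real.cos (b - a) - ω.re * Real.sin (a + b) := by
  have hn := dot_self_of_norm_one hω
  rw [zeta_coe, zeta_coe, Real.cos_sub, Real.sin_add]
  simp only [dot, Complex.sub_re, Complex.sub_im, Complex.ofReal_re, Complex.ofReal_im,
    Complex.re_mul_ofReal, Complex.im_mul_ofReal]
  linear_combination (Real.sin a * Real.sin b) * hn

lemma arc_subset_cone {ω : ℂ} (him : ω.im < 0) {a l : ℝ} (hl : l < Real.pi) :
    arc a l ⊆ cone ω (zeta ω (a : AddCircle (2 * Real.pi)))
      (zeta ω ((a + l : ℝ) : AddCircle (2 * Real.pi))) := by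
  rintro _ ⟨x, ⟨hx1, hx2⟩, rfl⟩
  refine ⟨?_, ?_⟩
  · change 0 < cross _ (zeta ω (x : AddCircle (2 * Real.pi)))
    rw [cross_zeta_coe]
    exact mul_pos (neg_pos.2 him) (Real.sin_pos_of_pos_of_lt_pi (by linarith) (by linarith))
  · change cross _ (zeta ω (x : AddCircle (2 * Real.pi))) < 0
    rw [cross_zeta_coe]
    exact mul_neg_of_pos_of_neg (neg_pos.2 him)
      (Real.sin_neg_of_neg_of_neg_pi_lt (by linarith) (by linarith))

lemma exists_rotation {δ E : ℝ} (hδ : 0 < δ) (hδ' : δ < 1) (hE : δ < |E|) (hE' : |E| < 2 - δ) :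
    ∃ ω : ℂ, ‖ω‖ = 1 ∧ ω.re = E / 2 ∧ ω.im ≤ -(δ / 2) ∧ δ ^ 2 ≤ ‖ω ^ 2 - 1‖ ∧
      δ ^ 2 ≤ ‖ω ^ 4 - 1‖ := by
  have hE2 : E ^ 2 ≤ (2 - δ) ^ 2 := by
    rw [← sq_abs]; exact pow_le_pow_left₀ (abs_nonneg _) hE'.le 2
  have hrad : (δ / 2) ^ 2 ≤ 1 - E ^ 2 / 4 := by nlinarith
  set σ := Real.sqrt (1 - E ^ 2 / 4) with hσ
  have hσδ : δ / 2 ≤ σ := Real.le_sqrt_of_sq_le hrad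
  have hσ2 : σ ^ 2 = 1 - E ^ 2 / 4 := Real.sq_sqrt ((sq_nonneg _).trans hrad)
  set ω : ℂ := ⟨E / 2, -σ⟩ with hωdef
  have hω : ‖ω‖ = 1 := by
    have : ‖ω‖ ^ 2 = 1 := by
      rw [norm_sq_eq_dot]; simp only [dot, hωdef]; linarith
    exact (pow_eq_one_iff_of_nonneg (norm_nonneg ω) two_ne_zero).1 this
  have h2 : ‖ω ^ 2 - 1‖ = 2 * σ := by
    have : ω ^ 2 - 1 = ω * (((-2 * σ : ℝ) : ℂ) * Complex.I) := by
      apply Complex.ext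
      · simp [hωdef, pow_two]; linarith
      · simp [hωdef, pow_two]; ring
    rw [this, norm_mul, norm_mul, hω, Complex.norm_I, Complex.norm_real, Real.norm_eq_abs, abs_mul,
      abs_of_pos (show 0 < σ by linarith)]
    norm_num
  have h2' : ‖ω ^ 2 + 1‖ = |E| := by
    have : ω ^ 2 + 1 = ω * (E : ℂ) := by
      apply Complex.ext
      · simp [hωdef, pow_two]; linarith
      · simp [hωdef, pow_two]; ring
    rw [this, norm_mul, hω, Complex.norm_real, Real.norm_eq_abs, one_mul]
  refine ⟨ω, hω, rfl, neg_le_neg hσδ, ?_, ?_⟩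
  · rw [h2]; nlinarith
  · rw [show ω ^ 4 - 1 = (ω ^ 2 - 1) * (ω ^ 2 + 1) by ring, norm_mul, h2, h2']
    nlinarith

end Arcs

/-- **Lemma 6.** There are `c₁, C, λ₀ > 0`, independent of `λ`, such that for
`0 < λ < λ₀` and `δ₀ < |E| < 2 - δ₀`, the Furstenberg measure satisfies
`ν(I) ≤ C |I|^{c₁/2}` for every arc `I`; in particular `dim ν_E^{(λ)}` is bounded
below by a positive constant independent of `λ`. -/
theorem furstenberg_dimension_uniform_lower_bound
    (δ₀ : ℝ) (hδ₀ : 0 < δ₀) (hδ₀' : δ₀ < 1) :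
    ∃ c₁ C lam0 : ℝ, 0 < c₁ ∧ 0 < C ∧ 0 < lam0 ∧
      ∀ lam : ℝ, 0 < lam → lam < lam0 →
        ∀ E : ℝ, δ₀ < |E| → |E| < 2 - δ₀ →
          ∀ ν : Measure (AddCircle (2 * Real.pi)),
            IsProbabilityMeasure ν → Stationary lam E ν →
            ∀ a l : ℝ, 0 < l →
              ν (arc a l) ≤ ENNReal.ofReal (C * l ^ (c₁ / 2)) := by
  have he : (1 / 200 : ℝ) / 2 = 1 / 400 := by norm_num
  set K : ℝ := Real.exp 1 * 2 ^ (1 / 400 : ℝ)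
  set B : ℝ := Real.exp 1 * (δ₀ / 2) ^ (-(1 / 200) : ℝ)
  have hK : 0 < K := by positivity
  have hB : 0 < B := by positivity
  have hδp : 0 < δ₀ ^ (-(1 / 400) : ℝ) := Real.rpow_pos_of_pos hδ₀ _
  refine ⟨1 / 200, K * B + δ₀ ^ (-(1 / 400) : ℝ), δ₀ ^ 3 / 128, by norm_num, by positivity,
    by positivity, fun lam hlam hlam0 E hE hE' ν hν hst a l hl => ?_⟩
  rw [he]
  have hlp : 0 < l ^ (1 / 400 : ℝ) := Real.rpow_pos_of_pos hl _
  rw [ENNReal.le_ofReal_iff_toReal_le (measure_ne_top _ _) (by positivity)]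
  change ν.real (arc a l) ≤ _
  by_cases hlδ : δ₀ ≤ l
  · have h1 : 1 ≤ δ₀ ^ (-(1 / 400) : ℝ) * l ^ (1 / 400 : ℝ) := by
      rw [Real.rpow_neg hδ₀.le, inv_mul_eq_div, le_div_iff₀ (Real.rpow_pos_of_pos hδ₀ _), one_mul]
      exact Real.rpow_le_rpow hδ₀.le hlδ (by norm_num)
    have h2 : ν.real (arc a l) ≤ 1 := measureReal_le_one
    nlinarith [mul_pos (mul_pos hK hB) hlp]
  push Not at hlδ
  obtain ⟨ω, hω, hre, him, h2, h4⟩ := exists_rotation hδ₀ hδ₀' hE hE'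
  have him0 : ω.im < 0 := by linarith
  rw [show E = 2 * ω.re by linarith] at hst
  have hpi : l < Real.pi := by linarith [Real.pi_gt_three]
  have hm : 0 < δ₀ ^ 2 := by positivity
  have hm1 : δ₀ ^ 2 ≤ 1 := pow_le_one₀ hδ₀.le hδ₀'.le
  have ht : 0 < lam / -ω.im := div_pos hlam (by linarith)
  have htm : lam / -ω.im ≤ δ₀ ^ 2 / 64 := by
    rw [div_le_iff₀ (by linarith)]
    nlinarith [mul_le_mul_of_nonneg_left (show δ₀ / 2 ≤ -ω.im by linarith) hm.le]
  have hre1 : |ω.re| ≤ 1 - δ₀ / 2 := by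
    rw [hre, abs_div, abs_two]; linarith
  have hcos_sin : ∀ x : ℝ, ω.re * Real.sin x ≤ 1 - δ₀ / 2 := fun x => by
    refine (le_abs_self _).trans ?_
    rw [abs_mul]
    exact (mul_le_of_le_one_right (abs_nonneg _) (Real.abs_sin_le_one x)).trans hre1
  set z := zeta ω (a : AddCircle (2 * Real.pi)) with hz
  set w := zeta ω ((a + l : ℝ) : AddCircle (2 * Real.pi)) with hw
  have hz0 : z ≠ 0 := zeta_ne_zero him0.ne _
  have hw0 : w ≠ 0 := zeta_ne_zero him0.ne _
  have hdot : 0 < dot z w := by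
    rw [hz, hw, dot_zeta_coe hω, add_sub_cancel_left]
    have := Real.one_sub_sq_div_two_le_cos (x := l)
    nlinarith [hcos_sin (a + (a + l))]
  have hcr : cross z w = -ω.im * Real.sin l := by
    rw [hz, hw, cross_zeta_coe, add_sub_cancel_left]
  have hsin : 0 < Real.sin l := Real.sin_pos_of_pos_of_lt_pi hl hpi
  have hcross : 0 < cross z w := by rw [hcr]; exact mul_pos (by linarith) hsin
  have hcrl : cross z w ≤ l := by
    rw [hcr]
    have h1 : -ω.im ≤ 1 := by
      have := Complex.abs_im_le_norm ω
      rw [hω] at this; linarith [(abs_le.1 this).1]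
    exact (mul_le_of_le_one_left hsin.le h1).trans (Real.sin_le hl.le)
  have hnorm : ∀ x : ℝ, δ₀ / 2 ≤ ‖zeta ω (x : AddCircle (2 * Real.pi))‖ := fun x => by
    refine le_of_pow_le_pow_left₀ two_ne_zero (norm_nonneg _) ?_
    rw [norm_sq_eq_dot, dot_zeta_coe hω, sub_self, Real.cos_zero]
    nlinarith [hcos_sin (x + x)]
  have hlyap : ∀ x : ℝ, lyap ω (lam / -ω.im) (zeta ω (x : AddCircle (2 * Real.pi))) ≤ B :=
    fun x => (lyap_bounds hm hm1 h2 h4 ht htm (zeta_ne_zero him0.ne _)).2.trans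
      (mul_le_mul_of_nonneg_left
        (Real.rpow_le_rpow_of_nonpos (by positivity) (hnorm x) (by norm_num)) (Real.exp_pos _).le)
  have hpot : pairPot ω (lam / -ω.im) z w ≤ l ^ (1 / 400 : ℝ) * B := by
    refine mul_le_mul (Real.rpow_le_rpow hcross.le hcrl (by norm_num)) ?_ ?_ hlp.le
    · linarith [hlyap a, hlyap (a + l)]
    · unfold lyap; positivity
  calc ν.real (arc a l) ≤ ν.real (cone ω z w) := measureReal_mono (arc_subset_cone him0 hpi)
    _ ≤ K * pairPot ω (lam / -ω.im) z w := hst.real_cone_le hlam.ne' hω him0.ne hm hm1 h2 h4 rfl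
        ht htm hz0 hw0 hdot hcross
    _ ≤ K * (l ^ (1 / 400 : ℝ) * B) := mul_le_mul_of_nonneg_left hpot hK.le
    _ ≤ _ := by nlinarith [mul_pos hδp hlp]
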